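/- arXiv:0911.3971 — 2 statements merged into one kernel-verified Lean document; each statement's English description precedes it below -/
import Mathlib

section
/- There exist α ∈ [0, π/2] and a constant C > 0 such that for all positive integers k, all integers p, and all positive integers q, one has |tan(α − 2^{−k}) − p/q| > C / (q² (log q)²), where log q denotes max{1, log₂ q}. -/
noncomputable section

/-- `plog q = max {1, log₂ q}`. -/
def plog (q : ℕ) : ℝ := max 1 (Real.logb 2 q)

open Finset in
/-- If at most half of the `M` children of a cell satisfy `A` and at most a quarter of its `M * M'`
grandchildren satisfy `B`, then some child avoids `A` and has at most half of its own children
in `B`. -/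
lemma exists_child_avoiding {M M' i : ℕ} (A B : ℕ → Prop) [DecidablePred A] [DecidablePred B]
    (hM : 0 < M)
    (hA : 2 * #{c ∈ Ico (i * M) ((i + 1) * M) | A c} ≤ M)
    (hB : 4 * #{u ∈ Ico (i * (M * M')) ((i + 1) * (M * M')) | B u} ≤ M * M') :
    ∃ c ∈ Ico (i * M) ((i + 1) * M),
      ¬ A c ∧ 2 * #{u ∈ Ico (c * M') ((c + 1) * M') | B u} ≤ M' := by
  by_contra! hcon
  set G := {c ∈ Ico (i * M) ((i + 1) * M) | ¬ A c} with hG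
  have hcard : #{c ∈ Ico (i * M) ((i + 1) * M) | A c} + #G = M := by
    rw [hG, card_filter_add_card_filter_not, Nat.card_Ico, add_mul]
    lia
  set s := {u ∈ Ico (i * (M * M')) ((i + 1) * (M * M')) | B u ∧ u / M' ∈ G}
  have hs : #s ≤ #{u ∈ Ico (i * (M * M')) ((i + 1) * (M * M')) | B u} :=
    card_le_card fun u hu ↦ by
      simp only [s, mem_filter] at hu ⊢
      exact ⟨hu.1, hu.2.1⟩
  have hcount : (M' / 2 + 1) * #G ≤ #s := by
    refine mul_card_image_le_card_of_maps_to (f := (· / M'))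
      (fun u hu ↦ (mem_filter.1 hu).2.2) _ fun c hc ↦ ?_
    have hc' := mem_filter.1 hc
    have h := hcon c hc'.1 hc'.2
    have hsub : {u ∈ Ico (c * M') ((c + 1) * M') | B u} ⊆ {u ∈ s | u / M' = c} := by
      intro u hu
      obtain ⟨hu1, hu2⟩ := mem_filter.1 hu
      obtain ⟨hl, hr⟩ := mem_Ico.1 hu1
      obtain ⟨hcl, hcr⟩ := mem_Ico.1 hc'.1
      have hdiv : u / M' = c := Nat.div_eq_of_lt_le hl hr
      have h1 : i * M * M' ≤ c * M' := Nat.mul_le_mul_right _ hcl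
      have h2 : (c + 1) * M' ≤ (i + 1) * M * M' := Nat.mul_le_mul_right _ hcr
      simp only [s, mem_filter, mem_Ico, hdiv, and_true]
      exact ⟨⟨by rw [← mul_assoc]; lia, by rw [← mul_assoc]; lia⟩, hu2, hc⟩
    have := card_le_card hsub
    lia
  have h1 : M' + 1 ≤ 2 * (M' / 2 + 1) := by lia
  have h2 : M ≤ 2 * #G := by lia
  have h3 : M * (M' + 1) ≤ (2 * #G) * (2 * (M' / 2 + 1)) := Nat.mul_le_mul h2 h1
  nlinarith

open Finset Classical in
/-- Iterating `exists_child_avoiding`: a descending sequence of cells along which the cell of level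
`j + 1` avoids `R j`. The predicate `V` singles out the cells on which the counting bound holds. -/
lemma exists_descending_cells (M : ℕ → ℕ) (hM : ∀ j, 0 < M j) (R V : ℕ → ℕ → Prop)
    (i₀ : ℕ) (hV₀ : V 0 i₀) (hR₀ : ∀ c, ¬ R 0 c)
    (hV : ∀ j i, V j i → ∀ c ∈ Ico (i * M j) ((i + 1) * M j), V (j + 1) c)
    (hR : ∀ j i, V j i →
      4 * #{u ∈ Ico (i * (M j * M (j + 1))) ((i + 1) * (M j * M (j + 1))) | R (j + 1) u} ≤
        M j * M (j + 1)) :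
    ∃ i : ℕ → ℕ, i 0 = i₀ ∧
      ∀ j, i (j + 1) ∈ Ico (i j * M j) ((i j + 1) * M j) ∧ ¬ R j (i (j + 1)) := by
  let P : ℕ → ℕ → Prop := fun j i ↦
    V j i ∧ 2 * #{c ∈ Ico (i * M j) ((i + 1) * M j) | R j c} ≤ M j
  have step : ∀ j i, P j i → ∃ c, P (j + 1) c ∧ c ∈ Ico (i * M j) ((i + 1) * M j) ∧ ¬ R j c := by
    rintro j i ⟨hv, hr⟩
    obtain ⟨c, hc, hRc, hcount⟩ :=
      exists_child_avoiding (R j) (R (j + 1)) (hM j) hr (hR j i hv)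
    exact ⟨c, ⟨hV j i hv c hc, hcount⟩, hc, hRc⟩
  choose! g hgP hg using step
  let i : ℕ → ℕ := fun j ↦ Nat.rec i₀ g j
  have hP : ∀ j, P j (i j) := by
    intro j
    induction j with
    | zero => exact ⟨hV₀, by simp [hR₀]⟩
    | succ j ih => exact hgP j _ ih
  exact ⟨i, rfl, fun j ↦ hg j _ (hP j)⟩

open Finset in
/-- A finite set of integers of diameter at most `L` has at most `L + 1` elements. -/
lemma card_le_of_forall_sub_le (s : Finset ℤ) {L : ℝ} (hL : 0 ≤ L)
    (h : ∀ x ∈ s, ∀ y ∈ s, (x : ℝ) - y ≤ L) : (#s : ℝ) ≤ L + 1 := by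
  rcases s.eq_empty_or_nonempty with rfl | hs
  · simp; linarith
  have hsub : s ⊆ Icc (s.min' hs) (s.max' hs) := fun x hx ↦
    mem_Icc.2 ⟨s.min'_le x hx, s.le_max' x hx⟩
  have hcard := card_le_card hsub
  rw [Int.card_Icc] at hcard
  have hmm : s.min' hs ≤ s.max' hs := s.min'_le_max' hs
  have hZ : (#s : ℤ) ≤ s.max' hs + 1 - s.min' hs := by lia
  have hR : (#s : ℝ) ≤ s.max' hs + 1 - s.min' hs := by exact_mod_cast hZ
  linarith [h _ (s.max'_mem hs) _ (s.min'_mem hs)]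

open Finset in
/-- Number of cells of length `1 / D` which contain a point `x` of `[lo, hi]` for which `f x` is
within `ρ` of a fraction of denominator `q`, for a function `f` which is expanding and
`κ`-Lipschitz on `[lo, hi]`. -/
lemma card_cells_near_fractions {f : ℝ → ℝ} {lo hi κ D ρ : ℝ} {q : ℕ} (s : Finset ℕ)
    (hD : 0 < D) (hρ : 0 ≤ ρ) (hκ : 0 ≤ κ) (hlohi : lo ≤ hi) (hq : 0 < q)
    (hexp : ∀ x ∈ Set.Icc lo hi, ∀ y ∈ Set.Icc lo hi, |x - y| ≤ |f x - f y|)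
    (hlip : ∀ x ∈ Set.Icc lo hi, ∀ y ∈ Set.Icc lo hi, |f x - f y| ≤ κ * |x - y|)
    (hs : ∀ u ∈ s, ∃ x ∈ Set.Icc (u / D) ((u + 1) / D), x ∈ Set.Icc lo hi ∧
      ∃ p : ℤ, |f x - p / q| ≤ ρ) :
    (#s : ℝ) ≤ (2 * ρ * D + 2) * (q * (κ * (hi - lo) + 2 * ρ) + 1) := by
  choose! x hxu hx p hp using hs
  have hq' : (0 : ℝ) < q := by exact_mod_cast hq
  have himage : (#(s.image p) : ℝ) ≤ q * (κ * (hi - lo) + 2 * ρ) + 1 := by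
    refine card_le_of_forall_sub_le _ (by have := sub_nonneg.2 hlohi; positivity) ?_
    simp only [mem_image]
    rintro _ ⟨u, hu, rfl⟩ _ ⟨v, hv, rfl⟩
    have h1 := abs_le.1 (hp u hu)
    have h2 := abs_le.1 (hp v hv)
    have h3 := (le_abs_self _).trans (hlip _ (hx u hu) _ (hx v hv))
    have h4 : |x u - x v| ≤ hi - lo := by
      have := hx u hu
      have := hx v hv
      simp only [Set.mem_Icc] at *
      exact abs_le.2 ⟨by linarith, by linarith⟩
    have h5 := mul_le_mul_of_nonneg_left h4 hκ
    have h6 : (p u : ℝ) / q - p v / q ≤ κ * (hi - lo) + 2 * ρ := by linarith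
    rwa [← sub_div, div_le_iff₀' hq'] at h6
  have hfiber : ∀ b ∈ s.image p, #{u ∈ s | p u = b} ≤ ⌊2 * ρ * D + 2⌋₊ := by
    intro b _
    refine Nat.le_floor ?_
    have h : (#({u ∈ s | p u = b}.image (fun n : ℕ ↦ (n : ℤ))) : ℝ) ≤ (2 * ρ * D + 1) + 1 := by
      refine card_le_of_forall_sub_le _ (by positivity) ?_
      simp only [mem_image, mem_filter]
      rintro _ ⟨u, ⟨hu, hub⟩, rfl⟩ _ ⟨v, ⟨hv, hvb⟩, rfl⟩
      have h1 := abs_le.1 (hp u hu)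
      have h2 := abs_le.1 (hp v hv)
      rw [hub] at h1
      rw [hvb] at h2
      have h3 : |x u - x v| ≤ 2 * ρ :=
        (hexp _ (hx u hu) _ (hx v hv)).trans (abs_le.2 ⟨by linarith, by linarith⟩)
      have h4 : (u : ℝ) ≤ x u * D := (div_le_iff₀ hD).1 (hxu u hu).1
      have h5 : x v * D ≤ v + 1 := (le_div_iff₀ hD).1 (hxu v hv).2
      have h6 := mul_le_mul_of_nonneg_right ((le_abs_self _).trans h3) hD.le
      push_cast
      linarith
    rw [card_image_of_injective _ Nat.cast_injective] at h
    linarith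
  have h := card_le_mul_card_image s _ hfiber
  calc (#s : ℝ) ≤ (⌊2 * ρ * D + 2⌋₊ : ℝ) * #(s.image p) := by exact_mod_cast h
    _ ≤ _ := mul_le_mul (Nat.floor_le (by positivity)) himage (by positivity) (by positivity)

lemma tan_slope_bounds_of_lt {x y : ℝ} (hy : 0 ≤ y) (hyx : y < x) (hx : x ≤ 1) :
    x - y ≤ Real.tan x - Real.tan y ∧ Real.tan x - Real.tan y ≤ 4 * (x - y) := by
  have hpi := Real.pi_gt_three
  have hcos : ∀ z ∈ Set.Icc y x, 1 / 2 ≤ Real.cos z := fun z hz ↦ by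
    rw [← Real.cos_pi_div_three]
    exact Real.cos_le_cos_of_nonneg_of_le_pi (hy.trans hz.1) (by linarith)
      (by linarith [hz.2])
  have hd : ∀ z ∈ Set.Icc y x, HasDerivAt Real.tan (1 / Real.cos z ^ 2) z := fun z hz ↦
    Real.hasDerivAt_tan (by linarith [hcos z hz])
  obtain ⟨z, hz, hslope⟩ := exists_hasDerivAt_eq_slope Real.tan _ hyx
    (fun z hz ↦ (hd z hz).continuousAt.continuousWithinAt)
    (fun z hz ↦ hd z (Set.Ioo_subset_Icc_self hz))
  have hxy : 0 < x - y := sub_pos.2 hyx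
  have hc := hcos z (Set.Ioo_subset_Icc_self hz)
  have hc1 := Real.cos_le_one z
  rw [eq_div_iff hxy.ne'] at hslope
  have hlow : 1 ≤ 1 / Real.cos z ^ 2 := by
    rw [le_div_iff₀ (by positivity)]
    nlinarith
  have hupp : 1 / Real.cos z ^ 2 ≤ 4 := by
    rw [div_le_iff₀ (by positivity)]
    nlinarith
  constructor <;> nlinarith

lemma tan_bilipschitz {x y : ℝ} (hx : x ∈ Set.Icc (0 : ℝ) 1) (hy : y ∈ Set.Icc (0 : ℝ) 1) :
    |x - y| ≤ |Real.tan x - Real.tan y| ∧ |Real.tan x - Real.tan y| ≤ 4 * |x - y| := by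
  wlog hxy : y < x generalizing x y
  · rcases (not_lt.1 hxy).eq_or_lt with rfl | h
    · simp
    · rw [abs_sub_comm x, abs_sub_comm (Real.tan x)]
      exact this hy hx h
  obtain ⟨h1, h2⟩ := tan_slope_bounds_of_lt hy.1 hxy hx.2
  rw [abs_of_pos (sub_pos.2 hxy), abs_of_nonneg (by linarith)]
  exact ⟨h1, h2⟩

open Finset in
/-- Dyadic bound for a block of the harmonic series. -/
lemma sum_one_div_Ico_two_pow_le (b n : ℕ) :
    ∑ q ∈ (Ico (2 ^ b) (2 ^ (b + n)) : Finset ℕ), (1 : ℝ) / q ≤ n := by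
  induction n with
  | zero => simp
  | succ n ih =>
    rw [← add_assoc, ← sum_Ico_consecutive _ (Nat.pow_le_pow_right two_pos (Nat.le_add_right b n))
      (Nat.pow_le_pow_right two_pos (Nat.le_add_right (b + n) 1))]
    have hblock : ∑ q ∈ (Ico (2 ^ (b + n)) (2 ^ (b + n + 1)) : Finset ℕ), (1 : ℝ) / q ≤ 1 := by
      calc ∑ q ∈ (Ico (2 ^ (b + n)) (2 ^ (b + n + 1)) : Finset ℕ), (1 : ℝ) / q
          ≤ ∑ q ∈ (Ico (2 ^ (b + n)) (2 ^ (b + n + 1)) : Finset ℕ), (1 : ℝ) / 2 ^ (b + n) := by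
            refine sum_le_sum fun q hq ↦ one_div_le_one_div_of_le (by positivity) ?_
            exact_mod_cast (mem_Ico.1 hq).1
        _ = 1 := by
            rw [sum_const, Nat.card_Ico, pow_succ, mul_two, Nat.add_sub_cancel, nsmul_eq_mul]
            push_cast
            field_simp
    push_cast
    linarith

/-- The exclusion radius around fractions of denominator `q`. -/
def excl (q : ℕ) : ℝ := (1 / 2) ^ 20 / ((q : ℝ) ^ 2 * plog q ^ 2)

lemma one_le_plog (q : ℕ) : 1 ≤ plog q := le_max_left _ _

lemma excl_pos {q : ℕ} (hq : 0 < q) : 0 < excl q := by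
  have := one_le_plog q
  unfold excl
  positivity

lemma le_plog {b q : ℕ} (h : 2 ^ b ≤ q) : (b : ℝ) ≤ plog q := by
  refine le_max_of_le_right ?_
  rw [Real.le_logb_iff_rpow_le one_lt_two (by have := Nat.two_pow_pos b; norm_cast; lia),
    Real.rpow_natCast]
  exact_mod_cast h

lemma plog_le {c q : ℕ} (hc : 1 ≤ c) (hq : 0 < q) (h : q ≤ 2 ^ c) : plog q ≤ c := by
  refine max_le (by exact_mod_cast hc) ?_
  rw [Real.logb_le_iff_le_rpow one_lt_two (by exact_mod_cast hq), Real.rpow_natCast]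
  exact_mod_cast h

/-- The radii in the batch `[2 ^ b, 2 ^ (4 * b + 12))` exceed the length of the cells used to
avoid that batch. -/
lemma le_excl {b q : ℕ} (hq : 0 < q) (h : q ≤ 2 ^ (4 * b + 12)) :
    (1 / 2) ^ (16 * b + 61) ≤ excl q := by
  have hq' : (0 : ℝ) < q := by exact_mod_cast hq
  have h1 : (q : ℝ) ≤ 2 ^ (4 * b + 12) := by exact_mod_cast h
  have h2 : plog q ≤ 2 ^ (b + 4) := by
    refine (plog_le (by lia) hq h).trans ?_
    have hb : b + 1 ≤ 2 ^ b := Nat.lt_two_pow_self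
    have : 4 * b + 12 ≤ 2 ^ (b + 4) := by rw [pow_add]; lia
    exact_mod_cast this
  have h0 := one_le_plog q
  unfold excl
  rw [le_div_iff₀ (by positivity)]
  calc (1 / 2 : ℝ) ^ (16 * b + 61) * ((q : ℝ) ^ 2 * plog q ^ 2)
      ≤ (1 / 2 : ℝ) ^ (16 * b + 61) * ((2 ^ (4 * b + 12)) ^ 2 * (2 ^ (b + 4)) ^ 2) := by gcongr
    _ = (1 / 2) ^ (6 * b + 29) := by
        rw [show 16 * b + 61 = (10 * b + 32) + (6 * b + 29) by ring, pow_add,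
          ← pow_mul, ← pow_mul, ← pow_add 2,
          show (4 * b + 12) * 2 + (b + 4) * 2 = 10 * b + 32 by ring, mul_right_comm, ← mul_pow]
        norm_num
    _ ≤ (1 / 2) ^ 20 := pow_le_pow_of_le_one (by norm_num) (by norm_num) (by lia)


open Finset in
/-- Number of cells, inside a cell of `[1/2, 1]`, that contain a solution of
`|tan (x - σ) - p / q| ≤ 2 * excl q` for a fixed shift `σ` and a fixed denominator `q`. -/
lemma card_cells_near_fractions_tan {b i q : ℕ} {σ : ℝ} (hσ₀ : 0 ≤ σ) (hσ : σ ≤ 1 / 2)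
    (hi₀ : 2 ^ b ≤ i) (hi : i < 2 ^ (b + 1)) (hq : q ∈ Ico (2 ^ b) (2 ^ (4 * b + 12)))
    (s : Finset ℕ) (hsub : s ⊆ Ico (i * 2 ^ (15 * b + 60)) ((i + 1) * 2 ^ (15 * b + 60)))
    (hs : ∀ u ∈ s, ∃ x ∈ Set.Icc ((u : ℝ) / 2 ^ (16 * b + 61)) ((u + 1) / 2 ^ (16 * b + 61)),
      ∃ p : ℤ, |Real.tan (x - σ) - p / q| ≤ 2 * excl q) :
    (#s : ℝ) ≤ (1 / 2) ^ 14 * 2 ^ (15 * b + 60) / max 1 (b : ℝ) ^ 2 * (1 / q) := by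
  obtain ⟨hq₁, hq₂⟩ := mem_Ico.1 hq
  have hq₀ : 0 < q := (Nat.two_pow_pos b).trans_le hq₁
  have hqR : (1 : ℝ) ≤ q := by exact_mod_cast hq₀
  have he := excl_pos hq₀
  have hD : (2 : ℝ) ^ (16 * b + 61) = 2 ^ (15 * b + 60) * 2 ^ (b + 1) := by
    rw [← pow_add]; congr 1; ring
  have hi₀R : (2 : ℝ) ^ b ≤ i := by exact_mod_cast hi₀
  have hiR : (i : ℝ) + 1 ≤ 2 ^ (b + 1) := by exact_mod_cast hi
  have hlo : (1 : ℝ) / 2 ≤ i / 2 ^ (b + 1) := by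
    rw [pow_succ, div_le_div_iff₀ two_pos (by positivity)]
    linarith
  have hhi : ((i : ℝ) + 1) / 2 ^ (b + 1) ≤ 1 := (div_le_one (by positivity)).2 hiR
  have hmem : ∀ x ∈ Set.Icc ((i : ℝ) / 2 ^ (b + 1)) ((i + 1) / 2 ^ (b + 1)),
      x - σ ∈ Set.Icc (0 : ℝ) 1 := fun x hx ↦ ⟨by linarith [hx.1], by linarith [hx.2]⟩
  have key := card_cells_near_fractions (f := fun x ↦ Real.tan (x - σ))
    (lo := i / 2 ^ (b + 1)) (hi := (i + 1) / 2 ^ (b + 1)) (κ := 4) (D := 2 ^ (16 * b + 61))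
    (ρ := 2 * excl q) (q := q) s (by positivity) (by positivity) (by norm_num)
    (by gcongr; linarith) hq₀
    (fun x hx y hy ↦ by simpa using (tan_bilipschitz (hmem x hx) (hmem y hy)).1)
    (fun x hx y hy ↦ by simpa using (tan_bilipschitz (hmem x hx) (hmem y hy)).2)
    (fun u hu ↦ by
      obtain ⟨x, hx, hp⟩ := hs u hu
      obtain ⟨h1, h2⟩ := mem_Ico.1 (hsub hu)
      have h1' : (i : ℝ) * 2 ^ (15 * b + 60) ≤ u := by exact_mod_cast h1
      have h2' : (u : ℝ) + 1 ≤ (i + 1) * 2 ^ (15 * b + 60) := by exact_mod_cast h2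
      refine ⟨x, hx, ⟨le_trans ?_ hx.1, hx.2.trans ?_⟩, hp⟩
      · rw [hD, div_le_div_iff₀ (by positivity) (by positivity), ← mul_assoc]
        gcongr
      · rw [hD, div_le_div_iff₀ (by positivity) (by positivity), ← mul_assoc]
        gcongr)
  have heD : 1 ≤ excl q * 2 ^ (16 * b + 61) := by
    have h := le_excl hq₀ hq₂.le
    rwa [one_div, inv_pow, inv_le_iff_one_le_mul₀ (by positivity)] at h
  have hL := one_le_plog q
  have heq : excl q * q * q * plog q ^ 2 = (1 / 2) ^ 20 := by
    unfold excl
    field_simp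
  have heq4 : 4 * (q * excl q) ≤ 1 := by
    have : q * excl q ≤ excl q * q * q * plog q ^ 2 := by
      have h1 : 1 ≤ q * plog q ^ 2 := one_le_mul_of_one_le_of_one_le hqR (one_le_pow₀ hL)
      have h2 : 0 < q * excl q := by positivity
      nlinarith
    rw [heq] at this
    norm_num at this
    linarith
  have hqℓ : 1 ≤ 2 * (q / 2 ^ (b + 1) : ℝ) := by
    have : (2 : ℝ) ^ b ≤ q := by exact_mod_cast hq₁
    rw [pow_succ, mul_div_assoc', le_div_iff₀ (by positivity)]
    linarith
  have hlen : ((i : ℝ) + 1) / 2 ^ (b + 1) - i / 2 ^ (b + 1) = 1 / 2 ^ (b + 1) := by ring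
  have hmax : max 1 (b : ℝ) ≤ plog q := max_le hL (le_plog hq₁)
  calc (#s : ℝ) ≤ _ := key
    _ ≤ (6 * (excl q * 2 ^ (16 * b + 61))) * (8 * (q / 2 ^ (b + 1))) := by
        rw [hlen]
        have h1 : (q : ℝ) * (4 * (1 / 2 ^ (b + 1)) + 2 * (2 * excl q)) + 1 =
          4 * (q / 2 ^ (b + 1)) + 4 * (q * excl q) + 1 := by ring
        rw [h1]
        gcongr <;> linarith
    _ = 48 * 2 ^ (15 * b + 60) * (excl q * q) := by
        rw [hD]
        field_simp
        ring
    _ = 48 * (1 / 2) ^ 20 * 2 ^ (15 * b + 60) / plog q ^ 2 * (1 / q) := by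
        rw [mul_assoc 48 ((1 / 2 : ℝ) ^ 20), ← heq]
        field_simp
    _ ≤ _ := by
        gcongr
        norm_num

/-- The cell of index `u` and length `2 ^ (-(16 * b + 61))` contains a point excluded by a
denominator in the batch `[2 ^ b, 2 ^ (4 * b + 12))`. -/
def Touched (b u : ℕ) : Prop :=
  ∃ x ∈ Set.Icc ((u : ℝ) / 2 ^ (16 * b + 61)) ((u + 1) / 2 ^ (16 * b + 61)),
    ∃ k : ℕ, 0 < k ∧ ∃ q ∈ (Finset.Ico (2 ^ b) (2 ^ (4 * b + 12)) : Finset ℕ), ∃ p : ℤ,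
      |Real.tan (x - (1 / 2) ^ k) - p / q| ≤ excl q

/-- The shifts that matter for a batch; index `0` stands for all the negligible ones. -/
def shift (k : ℕ) : ℝ := if k = 0 then 0 else (1 / 2) ^ k

lemma shift_nonneg (k : ℕ) : 0 ≤ shift k := by
  unfold shift
  split_ifs <;> positivity

lemma half_pow_le_half {k : ℕ} (hk : 0 < k) : (1 / 2 : ℝ) ^ k ≤ 1 / 2 :=
  pow_le_of_le_one (by norm_num) (by norm_num) hk.ne'

lemma shift_le_half (k : ℕ) : shift k ≤ 1 / 2 := by
  unfold shift
  split_ifs with h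
  · norm_num
  · exact half_pow_le_half (Nat.pos_of_ne_zero h)

/-- A large shift index may be replaced by the zero shift at the cost of doubling the radius. -/
lemma exists_shift_of_near {b k q : ℕ} {x : ℝ} {p : ℤ} (hk : 0 < k) (hx : x ∈ Set.Icc (1 / 2) 1)
    (hq : 0 < q) (hq' : q ≤ 2 ^ (4 * b + 12))
    (h : |Real.tan (x - (1 / 2) ^ k) - p / q| ≤ excl q) :
    ∃ m ∈ Finset.range (16 * b + 63), |Real.tan (x - shift m) - p / q| ≤ 2 * excl q := by
  have he := excl_pos hq
  by_cases hkb : k < 16 * b + 63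
  · refine ⟨k, Finset.mem_range.2 hkb, ?_⟩
    rw [shift, if_neg hk.ne']
    linarith
  · refine ⟨0, by simp, ?_⟩
    have hhalf := half_pow_le_half hk
    have hpos : (0 : ℝ) < (1 / 2) ^ k := by positivity
    have hlip := (tan_bilipschitz (x := x) (y := x - (1 / 2) ^ k)
      ⟨by linarith [hx.1], hx.2⟩ ⟨by linarith [hx.1], by linarith [hx.2]⟩).2
    rw [sub_sub_cancel, abs_of_pos hpos] at hlip
    have hsmall : 4 * (1 / 2 : ℝ) ^ k ≤ excl q := by
      have h1 : (1 / 2 : ℝ) ^ k ≤ (1 / 2) ^ (16 * b + 61 + 2) :=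
        pow_le_pow_of_le_one (by norm_num) (by norm_num) (by lia)
      rw [pow_add] at h1
      linarith [le_excl hq hq']
    rw [shift, if_pos rfl, sub_zero]
    calc |Real.tan x - p / q|
        ≤ |Real.tan x - Real.tan (x - (1 / 2) ^ k)| + |Real.tan (x - (1 / 2) ^ k) - p / q| :=
          abs_sub_le _ _ _
      _ ≤ 2 * excl q := by linarith

lemma batch_weight_le (b : ℕ) :
    4 * ((1 / 2 : ℝ) ^ 14 * ((16 * b + 63) * (3 * b + 12))) ≤ max 1 (b : ℝ) ^ 2 := by
  rcases Nat.eq_zero_or_pos b with rfl | hb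
  · norm_num
  · have hb' : (1 : ℝ) ≤ b := by exact_mod_cast hb
    rw [max_eq_right hb']
    norm_num
    nlinarith

open Finset Classical in
/-- At most a quarter of the small cells in a cell of `[1/2, 1]` are touched by a batch. -/
lemma four_mul_card_touched_le {b i : ℕ} (hi₀ : 2 ^ b ≤ i) (hi : i < 2 ^ (b + 1)) :
    4 * #{u ∈ Ico (i * 2 ^ (15 * b + 60)) ((i + 1) * 2 ^ (15 * b + 60)) | Touched b u} ≤
      2 ^ (15 * b + 60) := by
  set I := Ico (i * 2 ^ (15 * b + 60)) ((i + 1) * 2 ^ (15 * b + 60)) with hI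
  let S : ℕ × ℕ → Finset ℕ := fun mq ↦ {u ∈ I |
    ∃ x ∈ Set.Icc ((u : ℝ) / 2 ^ (16 * b + 61)) ((u + 1) / 2 ^ (16 * b + 61)),
      ∃ p : ℤ, |Real.tan (x - shift mq.1) - p / mq.2| ≤ 2 * excl mq.2}
  set B := range (16 * b + 63) ×ˢ Ico (2 ^ b) (2 ^ (4 * b + 12)) with hB
  have hcover : {u ∈ I | Touched b u} ⊆ B.biUnion S := by
    intro u hu
    obtain ⟨huI, x, hx, k, hk, q, hq, p, hp⟩ := mem_filter.1 hu
    obtain ⟨hq₁, hq₂⟩ := mem_Ico.1 hq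
    obtain ⟨h1, h2⟩ := mem_Ico.1 huI
    have hx' : x ∈ Set.Icc (1 / 2 : ℝ) 1 := by
      have h1' : 2 ^ b * 2 ^ (15 * b + 60) ≤ u := (Nat.mul_le_mul_right _ hi₀).trans h1
      have h2' : u + 1 ≤ 2 ^ (b + 1) * 2 ^ (15 * b + 60) :=
        le_trans h2 (Nat.mul_le_mul_right _ hi)
      rw [← pow_add] at h1' h2'
      rw [show b + (15 * b + 60) = 16 * b + 60 by ring] at h1'
      rw [show b + 1 + (15 * b + 60) = 16 * b + 61 by ring] at h2'
      have h1R : (2 : ℝ) ^ (16 * b + 60) ≤ u := by exact_mod_cast h1'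
      have h2R : (u : ℝ) + 1 ≤ 2 ^ (16 * b + 61) := by exact_mod_cast h2'
      refine ⟨le_trans ?_ hx.1, hx.2.trans ((div_le_one (by positivity)).2 h2R)⟩
      rw [div_le_div_iff₀ two_pos (by positivity), pow_succ]
      linarith
    obtain ⟨m, hm, hnear⟩ :=
      exists_shift_of_near hk hx' ((Nat.two_pow_pos b).trans_le hq₁) hq₂.le hp
    exact mem_biUnion.2 ⟨(m, q), mem_product.2 ⟨hm, hq⟩, mem_filter.2 ⟨huI, x, hx, p, hnear⟩⟩
  set W : ℝ := (1 / 2) ^ 14 * 2 ^ (15 * b + 60) / max 1 (b : ℝ) ^ 2 with hW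
  have hW₀ : 0 ≤ W := by positivity
  have hcard : (#{u ∈ I | Touched b u} : ℝ) ≤ (16 * b + 63) * (W * (3 * b + 12)) := by
    calc (#{u ∈ I | Touched b u} : ℝ) ≤ ∑ mq ∈ B, (#(S mq) : ℝ) := by
          exact_mod_cast (card_le_card hcover).trans card_biUnion_le
      _ ≤ ∑ mq ∈ B, W * (1 / mq.2) := by
          refine sum_le_sum fun mq hmq ↦ ?_
          exact card_cells_near_fractions_tan (shift_nonneg _) (shift_le_half _) hi₀ hi
            (mem_product.1 hmq).2 _ (filter_subset _ _) fun u hu ↦ (mem_filter.1 hu).2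
      _ = (16 * b + 63) *
          (W * ∑ q ∈ (Ico (2 ^ b) (2 ^ (4 * b + 12)) : Finset ℕ), (1 : ℝ) / q) := by
          simp only [hB, sum_product, sum_const, card_range, nsmul_eq_mul, mul_sum]
          push_cast
          rfl
      _ ≤ _ := by
          have h := sum_one_div_Ico_two_pow_le b (3 * b + 12)
          rw [show b + (3 * b + 12) = 4 * b + 12 by ring] at h
          push_cast at h
          gcongr
  have hfinal : 4 * ((16 * b + 63) * (W * (3 * b + 12))) ≤ (2 : ℝ) ^ (15 * b + 60) := by
    calc 4 * ((16 * b + 63) * (W * (3 * b + 12)))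
        = 4 * ((1 / 2 : ℝ) ^ 14 * ((16 * b + 63) * (3 * b + 12))) * 2 ^ (15 * b + 60) /
            max 1 (b : ℝ) ^ 2 := by
          rw [hW]
          ring
      _ ≤ _ := by
          rw [div_le_iff₀ (by positivity), mul_comm ((2 : ℝ) ^ (15 * b + 60))]
          exact mul_le_mul_of_nonneg_right (batch_weight_le b) (by positivity)
  have : (4 * #{u ∈ I | Touched b u} : ℝ) ≤ 2 ^ (15 * b + 60) := by linarith
  exact_mod_cast this

/-- Dyadic exponents at which the batches of denominators start. -/
def level : ℕ → ℕ
  | 0 => 0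
  | j + 1 => 4 * level j + 12

lemma le_level (j : ℕ) : j ≤ level j := by
  induction j with
  | zero => simp
  | succ j ih => rw [level]; lia

lemma exists_level {q : ℕ} (hq : 0 < q) :
    ∃ j, q ∈ Finset.Ico (2 ^ level j) (2 ^ (4 * level j + 12)) := by
  have hex : ∃ j, q < 2 ^ level j :=
    ⟨q, Nat.lt_two_pow_self.trans_le (Nat.pow_le_pow_right two_pos (le_level q))⟩
  classical
  obtain ⟨n, hn⟩ : ∃ n, Nat.find hex = n + 1 := by
    refine Nat.exists_eq_succ_of_ne_zero fun h ↦ ?_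
    have := Nat.find_spec hex
    rw [h] at this
    simp only [level, pow_zero] at this
    lia
  refine ⟨n, Finset.mem_Ico.2 ⟨not_lt.1 (Nat.find_min hex (by lia)), ?_⟩⟩
  have := Nat.find_spec hex
  rwa [hn] at this

/-- Being touched by the batch preceding the `j`-th one. -/
def TouchedBefore : ℕ → ℕ → Prop
  | 0, _ => False
  | j + 1, u => Touched (level j) u

/-- A point of `[1/2, 1]` avoiding every batch. -/
lemma exists_forall_not_near :
    ∃ x ∈ Set.Icc (1 / 2 : ℝ) 1, ∀ k : ℕ, 0 < k → ∀ (p : ℤ) (q : ℕ), 0 < q →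
      excl q < |Real.tan (x - (1 / 2) ^ k) - p / q| := by
  classical
  let M : ℕ → ℕ := fun j ↦ 2 ^ (3 * level j + 12)
  have hMM : ∀ j, M j * M (j + 1) = 2 ^ (15 * level j + 60) := fun j ↦ by
    simp only [M, level, ← pow_add]
    congr 1
    ring
  have hLM : ∀ j, 2 ^ level j * M j = 2 ^ level (j + 1) := fun j ↦ by
    simp only [M, level, ← pow_add]
    congr 1
    ring
  obtain ⟨i, hi₀, hi⟩ := exists_descending_cells M (fun j ↦ Nat.two_pow_pos _) TouchedBefore
    (fun j i ↦ 2 ^ level j ≤ i ∧ i < 2 ^ (level j + 1)) 1 (by simp [level]) (fun c ↦ id)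
    (by
      rintro j i ⟨h1, h2⟩ c hc
      obtain ⟨hc1, hc2⟩ := Finset.mem_Ico.1 hc
      have h3 := (Nat.mul_le_mul_right (M j) h1).trans hc1
      have h4 := hc2.trans_le (Nat.mul_le_mul_right (M j) h2)
      rw [pow_succ, mul_right_comm] at h4
      rw [hLM] at h3 h4
      exact ⟨h3, by rwa [pow_succ]⟩)
    (by
      rintro j i ⟨h1, h2⟩
      simp only [hMM, TouchedBefore]
      exact four_mul_card_touched_le h1 h2)
  let t : ℕ → Set ℝ := fun j ↦
    Set.Icc ((i j : ℝ) / 2 ^ (level j + 1)) ((i j + 1) / 2 ^ (level j + 1))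
  have hsucc : ∀ j, (2 : ℝ) ^ (level (j + 1) + 1) = M j * 2 ^ (level j + 1) := fun j ↦ by
    simp only [M, level, Nat.cast_pow, Nat.cast_ofNat, ← pow_add]
    congr 1
    ring
  obtain ⟨x, hx⟩ := IsCompact.nonempty_iInter_of_sequence_nonempty_isCompact_isClosed t
    (fun j ↦ by
      obtain ⟨h1, h2⟩ := Finset.mem_Ico.1 (hi j).1
      have h1' : (i j : ℝ) * M j ≤ i (j + 1) := by exact_mod_cast h1
      have h2' : (i (j + 1) : ℝ) + 1 ≤ (i j + 1) * M j := by exact_mod_cast h2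
      have hM : (0 : ℝ) < M j := by positivity
      refine Set.Icc_subset_Icc ?_ ?_ <;>
      · rw [hsucc, div_le_div_iff₀ (by positivity) (by positivity), ← mul_assoc]
        gcongr)
    (fun j ↦ Set.nonempty_Icc.2 (by gcongr; linarith)) isCompact_Icc (fun j ↦ isClosed_Icc)
  rw [Set.mem_iInter] at hx
  refine ⟨x, ?_, fun k hk p q hq ↦ ?_⟩
  · have h0 := hx 0
    simp only [t, hi₀, level] at h0
    norm_num at h0
    exact h0
  · obtain ⟨j, hj⟩ := exists_level hq
    by_contra! hle
    refine (hi (j + 1)).2 ⟨x, ?_, k, hk, q, hj, p, hle⟩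
    have h := hx (j + 2)
    simp only [t] at h
    rwa [show level (j + 2) + 1 = 16 * level j + 61 by simp only [level]; ring] at h

/-- There exist `α ∈ [0, π/2]` and `C > 0` such that for all positive integers `k`,
all integers `p` and all positive integers `q`,
`|tan(α - 2^{-k}) - p/q| > C / (q² (log q)²)` where `log q = max {1, log₂ q}`. -/
theorem lacunary_diophantine :
    ∃ α ∈ Set.Icc (0:ℝ) (Real.pi / 2), ∃ C : ℝ, 0 < C ∧
      ∀ k : ℕ, 0 < k → ∀ (p : ℤ) (q : ℕ), 0 < q →
        |Real.tan (α - 2 ^ (-(k : ℝ))) - (p : ℝ) / (q : ℝ)| >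
          C / ((q : ℝ) ^ 2 * (plog q) ^ 2) := by
  obtain ⟨x, hx, h⟩ := exists_forall_not_near
  refine ⟨x, ⟨by linarith [hx.1], by linarith [hx.2, Real.pi_gt_three]⟩, (1 / 2) ^ 20,
    by positivity, fun k hk p q hq ↦ ?_⟩
  rw [Real.rpow_neg two_pos.le, Real.rpow_natCast, ← inv_pow, ← one_div]
  exact h k hk p q hq

end
end

section
/- Let M ≥ 1 and let Ω ⊆ [0, π/2] satisfy the order-M lacunary covering property. Then there exist α ∈ [0, π/2] and a constant C > 0 such that for all θ ∈ Ω, all integers p, and all positive integers q, one has |tan(α − θ) − p/q| > C / (q² (log q)^{2M}), where log q denotes max{1, log₂ q}. -/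
noncomputable section

/-- `Ω` satisfies the order-`M` lacunary covering property: there is a constant `K` such
that for every `0 < δ < 1/2` the set `Ω` can be covered by at most `K (log₂(1/δ))^M`
intervals of length `δ`. -/
def LacunaryCovering (Ω : Set ℝ) (M : ℕ) : Prop :=
  ∃ K : ℝ, ∀ δ : ℝ, 0 < δ → δ < 1 / 2 →
    ∃ s : Finset ℝ, (s.card : ℝ) ≤ K * (Real.logb 2 (1 / δ)) ^ M ∧
      Ω ⊆ ⋃ x ∈ s, Set.Icc x (x + δ)

/-- A set of diameter at most `D` whose points are `σ`-separated has at most `D / σ + 1`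
elements. -/
theorem exists_finset_of_separated {S : Set ℝ} {σ D : ℝ} (hσ : 0 < σ) (hD : 0 ≤ D)
    (hdiam : ∀ r ∈ S, ∀ t ∈ S, |r - t| ≤ D)
    (hsep : ∀ r ∈ S, ∀ t ∈ S, r ≠ t → σ ≤ |r - t|) :
    ∃ F : Finset ℝ, S ⊆ F ∧ (F.card : ℝ) ≤ D / σ + 1 := by
  rcases S.eq_empty_or_nonempty with rfl | ⟨r₀, hr₀⟩
  · exact ⟨∅, by simp, by simp; positivity⟩
  have hbdd : BddBelow S :=
    ⟨r₀ - D, fun t ht => by linarith [(abs_le.mp (hdiam r₀ hr₀ t ht)).2]⟩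
  have hlow : ∀ r ∈ S, 0 ≤ (r - sInf S) / σ := fun r hr =>
    div_nonneg (sub_nonneg.mpr (csInf_le hbdd hr)) hσ.le
  have hup : ∀ r ∈ S, (r - sInf S) / σ ≤ D / σ := fun r hr => by
    have : r - D ≤ sInf S := le_csInf ⟨r₀, hr₀⟩ fun t ht => by
      linarith [(abs_le.mp (hdiam r hr t ht)).2]
    gcongr
    linarith
  have hmaps : Set.MapsTo (fun r => ⌊(r - sInf S) / σ⌋₊) S
      (Finset.range (⌊D / σ⌋₊ + 1) : Finset ℕ) := fun r hr => by
    simpa [Nat.lt_succ_iff] using Nat.floor_le_floor (hup r hr)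
  have hinj : Set.InjOn (fun r => ⌊(r - sInf S) / σ⌋₊) S := by
    intro r hr t ht h
    by_contra hne
    have h' : ⌊(r - sInf S) / σ⌋₊ = ⌊(t - sInf S) / σ⌋₊ := h
    have h1 := Nat.floor_le (hlow r hr)
    have h2 := Nat.lt_floor_add_one ((r - sInf S) / σ)
    have h3 := Nat.floor_le (hlow t ht)
    have h4 := Nat.lt_floor_add_one ((t - sInf S) / σ)
    rw [h'] at h1 h2
    have h5 : |(r - sInf S) / σ - (t - sInf S) / σ| < 1 := abs_lt.mpr ⟨by linarith, by linarith⟩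
    rw [← sub_div, sub_sub_sub_cancel_right, abs_div, abs_of_pos hσ, div_lt_one hσ] at h5
    linarith [hsep r hr t ht hne]
  have hfin : S.Finite := Set.Finite.of_injOn hmaps hinj (Finset.finite_toSet _)
  refine ⟨hfin.toFinset, by simp, ?_⟩
  have hcard : hfin.toFinset.card ≤ (Finset.range (⌊D / σ⌋₊ + 1)).card :=
    Finset.card_le_card_of_injOn _ (by simpa using hmaps) (by simpa using hinj)
  rw [Finset.card_range] at hcard
  have h1 : (hfin.toFinset.card : ℝ) ≤ ⌊D / σ⌋₊ + 1 := by exact_mod_cast hcard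
  linarith [Nat.floor_le (div_nonneg hD hσ.le)]

/-- Two distinct fractions with denominators less than `Q` differ by at least `1 / Q²`. -/
theorem inv_sq_le_abs_sub_of_ne {p p' : ℤ} {q q' Q : ℕ} (hq : 0 < q) (hq' : 0 < q')
    (hqQ : q < Q) (hqQ' : q' < Q) (hne : (p : ℝ) / q ≠ p' / q') :
    1 / (Q : ℝ) ^ 2 ≤ |(p : ℝ) / q - p' / q'| := by
  have h1 : (0 : ℝ) < q := by exact_mod_cast hq
  have h2 : (0 : ℝ) < q' := by exact_mod_cast hq'
  have h3 : (q : ℝ) ≤ Q := by exact_mod_cast hqQ.le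
  have h4 : (q' : ℝ) ≤ Q := by exact_mod_cast hqQ'.le
  have hz : p * q' - q * p' ≠ 0 := by
    intro h
    apply hne
    rw [div_eq_div_iff h1.ne' h2.ne']
    have : p * q' = p' * q := by linarith
    exact_mod_cast this
  have habs : (1 : ℝ) ≤ |(p : ℝ) * q' - q * p'| := by
    exact_mod_cast Int.one_le_abs hz
  rw [div_sub_div _ _ h1.ne' h2.ne', abs_div, abs_of_pos (mul_pos h1 h2)]
  gcongr
  rw [sq]
  gcongr

theorem half_le_cos_of_abs_le {x : ℝ} (hx : |x| ≤ Real.pi / 3) : 1 / 2 ≤ Real.cos x := by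
  rw [← Real.cos_abs, ← Real.cos_pi_div_three]
  exact Real.cos_le_cos_of_nonneg_of_le_pi (abs_nonneg x) (by linarith [Real.pi_pos]) hx

/-- The tangent is `4`-Lipschitz on `[-π/3, π/3]`. -/
theorem abs_tan_sub_tan_le {x y : ℝ} (hx : |x| ≤ Real.pi / 3) (hy : |y| ≤ Real.pi / 3) :
    |Real.tan x - Real.tan y| ≤ 4 * |x - y| := by
  have hcx := half_le_cos_of_abs_le hx
  have hcy := half_le_cos_of_abs_le hy
  have hpos : 1 / 4 ≤ Real.cos x * Real.cos y := by nlinarith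
  have heq : Real.tan x - Real.tan y = Real.sin (x - y) / (Real.cos x * Real.cos y) := by
    rw [Real.tan_eq_sin_div_cos, Real.tan_eq_sin_div_cos, div_sub_div _ _ (by linarith)
      (by linarith), Real.sin_sub]
  rw [heq, abs_div, abs_of_pos (by linarith : 0 < Real.cos x * Real.cos y),
    div_le_iff₀ (by linarith)]
  have hsin : |Real.sin (x - y)| ≤ |x - y| := Real.abs_sin_le_abs
  nlinarith [abs_nonneg (x - y)]

/-- The arctangent is `1`-Lipschitz. -/
theorem abs_arctan_sub_arctan_le (x y : ℝ) : |Real.arctan x - Real.arctan y| ≤ |x - y| := by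
  have h := Convex.norm_image_sub_le_of_norm_deriv_le (f := Real.arctan) (s := Set.univ) (C := 1)
    (x := y) (y := x) (fun z _ => Real.differentiable_arctan z)
    (fun z _ => by
      rw [Real.deriv_arctan, Real.norm_eq_abs, abs_of_pos (by positivity)]
      rw [div_le_one (by positivity)]
      nlinarith [sq_nonneg z]) convex_univ (Set.mem_univ _) (Set.mem_univ _)
  simpa using h

/-- An interval of length `L` contains a subinterval of length `ℓ` avoiding finitely many closed
intervals, as soon as the sum of their lengths, each enlarged by `ℓ`, is less than `L - ℓ`. -/
theorem exists_subinterval_avoiding (S : Finset ℕ) (P : ℕ → Finset ℝ) (r : ℕ → ℝ)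
    {a L ℓ : ℝ} (hr : ∀ m ∈ S, 0 ≤ r m) (hℓ : 0 ≤ ℓ)
    (hsum : ∑ m ∈ S, ((P m).card : ℝ) * (2 * r m + ℓ) < L - ℓ) :
    ∃ b ∈ Set.Icc a (a + L - ℓ), ∀ y ∈ Set.Icc b (b + ℓ), ∀ m ∈ S, ∀ c ∈ P m,
      r m < |y - c| := by
  set U : Set ℝ := ⋃ m ∈ S, ⋃ c ∈ P m, Set.Icc (c - r m - ℓ) (c + r m) with hU
  have hvol : MeasureTheory.volume U < MeasureTheory.volume (Set.Icc a (a + L - ℓ)) := by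
    calc MeasureTheory.volume U
        ≤ ∑ m ∈ S, ∑ c ∈ P m, MeasureTheory.volume (Set.Icc (c - r m - ℓ) (c + r m)) :=
          (MeasureTheory.measure_biUnion_finset_le _ _).trans
            (Finset.sum_le_sum fun m _ => MeasureTheory.measure_biUnion_finset_le _ _)
      _ = ENNReal.ofReal (∑ m ∈ S, ((P m).card : ℝ) * (2 * r m + ℓ)) := by
          rw [ENNReal.ofReal_sum_of_nonneg fun m hm => by have := hr m hm; positivity]
          refine Finset.sum_congr rfl fun m _ => ?_
          rw [ENNReal.ofReal_mul (by positivity), ENNReal.ofReal_natCast]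
          simp only [Real.volume_Icc]
          rw [Finset.sum_congr rfl fun c _ => by
            rw [show c + r m - (c - r m - ℓ) = 2 * r m + ℓ by ring]]
          simp
      _ < MeasureTheory.volume (Set.Icc a (a + L - ℓ)) := by
          have h0 : 0 ≤ ∑ m ∈ S, ((P m).card : ℝ) * (2 * r m + ℓ) :=
            Finset.sum_nonneg fun m hm => by have := hr m hm; positivity
          rw [Real.volume_Icc]
          exact (ENNReal.ofReal_lt_ofReal_iff (by linarith)).mpr (by linarith)
  have hnot : ¬ Set.Icc a (a + L - ℓ) ⊆ U := fun h =>
    (MeasureTheory.measure_mono h).not_gt hvol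
  obtain ⟨b, hb, hbU⟩ := Set.not_subset.mp hnot
  refine ⟨b, hb, fun y hy m hm c hc => ?_⟩
  by_contra hle
  obtain ⟨h1, h2⟩ := abs_le.mp (not_lt.mp hle)
  apply hbU
  rw [hU]
  simp only [Set.mem_iUnion]
  exact ⟨m, hm, c, hc, by linarith [hy.2], by linarith [hy.1]⟩

/-- The radius of the neighbourhoods removed at level `m`. -/
def levelRadius (M m : ℕ) : ℝ := 1 / ((4 : ℝ) ^ m * (m : ℝ) ^ (2 * M))

theorem levelRadius_pos (M : ℕ) {m : ℕ} (hm : 0 < m) : 0 < levelRadius M m := by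
  unfold levelRadius
  positivity

theorem levelRadius_mul_four_pow_le (M : ℕ) {m : ℕ} (hm : 0 < m) :
    levelRadius M m * 4 ^ m ≤ 1 := by
  have h1 : (1 : ℝ) ≤ m := by exact_mod_cast hm
  have h2 : (1 : ℝ) ≤ (m : ℝ) ^ (2 * M) := one_le_pow₀ h1
  unfold levelRadius
  rw [div_mul_eq_mul_div, one_mul, div_le_one (by positivity)]
  exact le_mul_of_one_le_right (by positivity) h2

/-- A lacunary set of order `M` is covered by `O(m ^ M)` intervals of length `levelRadius M m`. -/
theorem LacunaryCovering.exists_levelRadius_cover {Ω : Set ℝ} {M : ℕ}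
    (hcov : LacunaryCovering Ω M) :
    ∃ B : ℝ, 1 ≤ B ∧ ∀ m : ℕ, 0 < m → ∃ s : Finset ℝ, (s.card : ℝ) ≤ B * (m : ℝ) ^ M ∧
      Ω ⊆ ⋃ x ∈ s, Set.Icc x (x + levelRadius M m) := by
  obtain ⟨K, hK⟩ := hcov
  refine ⟨max 1 (|K| * (2 + 2 * M) ^ M), le_max_left _ _, fun m hm => ?_⟩
  have hm1 : (1 : ℝ) ≤ m := by exact_mod_cast hm
  have hδ := levelRadius_pos M hm
  have hδ' : levelRadius M m < 1 / 2 := by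
    have h := levelRadius_mul_four_pow_le M hm
    have h4 : (4 : ℝ) ≤ 4 ^ m := le_self_pow₀ (by norm_num) hm.ne'
    nlinarith
  obtain ⟨s, hs, hΩs⟩ := hK _ hδ hδ'
  refine ⟨s, hs.trans ?_, hΩs⟩
  have hlogm0 : 0 ≤ Real.logb 2 m := Real.logb_nonneg (by norm_num) hm1
  have hlogm : Real.logb 2 m ≤ m := by
    rw [Real.logb_le_iff_le_rpow (by norm_num) (by linarith), Real.rpow_natCast]
    exact_mod_cast (Nat.lt_two_pow_self (n := m)).le
  have hlog4 : Real.logb 2 4 = 2 := by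
    rw [show (4 : ℝ) = 2 ^ (2 : ℝ) by norm_num]
    exact Real.logb_rpow (by norm_num) (by norm_num)
  have hlog : Real.logb 2 (1 / levelRadius M m) = 2 * m + 2 * M * Real.logb 2 m := by
    unfold levelRadius
    rw [one_div_one_div, Real.logb_mul (by positivity) (by positivity), Real.logb_pow,
      Real.logb_pow, hlog4]
    push_cast
    ring
  rw [hlog]
  calc K * (2 * m + 2 * M * Real.logb 2 m) ^ M
      ≤ |K| * (2 * m + 2 * M * m) ^ M := by
        gcongr
        exact le_abs_self K
    _ = |K| * (2 + 2 * M) ^ M * (m : ℝ) ^ M := by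
        rw [mul_assoc |K|, ← mul_pow]
        ring
    _ ≤ _ := by
        gcongr
        exact le_max_right _ _

/-- `α` stays away from the fractions with denominators less than `2 ^ (k + 1)`, at the scale
of level `k + R`. -/
def GoodAt (Ω : Set ℝ) (M R k : ℕ) (α : ℝ) : Prop :=
  ∀ θ ∈ Ω, ∀ (p : ℤ) (q : ℕ), 0 < q → q < 2 ^ (k + 1) →
    levelRadius M (k + R) < |Real.tan (α - θ) - (p : ℝ) / (q : ℝ)|

/-- Inside a given interval, the points which are not good at a given level lie close to
a controlled number of centres. -/
theorem exists_centres {Ω : Set ℝ} {M R k : ℕ} {B a L : ℝ} (hΩ : Ω ⊆ Set.Icc 0 (Real.pi / 2))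
    (hR : 3 ≤ R) (hL : 0 ≤ L) (ha : Real.pi / 6 ≤ a) (haL : a + L ≤ Real.pi / 3)
    (hcover : ∃ s : Finset ℝ, (s.card : ℝ) ≤ B * ((k + R : ℕ) : ℝ) ^ M ∧
      Ω ⊆ ⋃ x ∈ s, Set.Icc x (x + levelRadius M (k + R))) :
    ∃ P : Finset ℝ, (P.card : ℝ) ≤ B * ((k + R : ℕ) : ℝ) ^ M * (2 + 16 * 4 ^ k * L) ∧
      ∀ α ∈ Set.Icc a (a + L), (∀ c ∈ P, 2 * levelRadius M (k + R) < |α - c|) →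
        GoodAt Ω M R k α := by
  obtain ⟨s, hs, hΩs⟩ := hcover
  set δ := levelRadius M (k + R) with hδdef
  have hδ : 0 < δ := levelRadius_pos M (by omega)
  have hδ4 : 24 * (4 ^ k * δ) ≤ 1 := by
    have h := levelRadius_mul_four_pow_le M (m := k + R) (by omega)
    rw [← hδdef, pow_add] at h
    have h64 : (4 : ℝ) ^ 3 ≤ 4 ^ R := pow_le_pow_right₀ (by norm_num) hR
    have h0 : 0 < (4 : ℝ) ^ k * δ := by positivity
    nlinarith
  have hF : ∀ x : ℝ, ∃ F : Finset ℝ, (F.card : ℝ) ≤ 2 + 16 * 4 ^ k * L ∧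
      ∀ α ∈ Set.Icc a (a + L), ∀ θ ∈ Set.Icc x (x + δ), |α - θ| ≤ Real.pi / 3 →
        ∀ (p : ℤ) (q : ℕ), 0 < q → q < 2 ^ (k + 1) →
          |Real.tan (α - θ) - (p : ℝ) / q| ≤ δ → (p : ℝ) / q ∈ F := by
    intro x
    obtain ⟨F, hSF, hcard⟩ := exists_finset_of_separated
      (S := {r : ℝ | ∃ (p : ℤ) (q : ℕ), 0 < q ∧ q < 2 ^ (k + 1) ∧ r = (p : ℝ) / q ∧
        ∃ α ∈ Set.Icc a (a + L), ∃ θ ∈ Set.Icc x (x + δ), |α - θ| ≤ Real.pi / 3 ∧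
          |Real.tan (α - θ) - r| ≤ δ})
      (σ := 1 / ((2 ^ (k + 1) : ℕ) : ℝ) ^ 2) (D := 4 * L + 6 * δ) (by positivity) (by positivity)
      (by
        rintro r ⟨p, q, -, -, -, α, hα, θ, hθ, hαθ, hr⟩ t ⟨p', q', -, -, -, β, hβ, φ, hφ, hβφ, ht⟩
        have h1 := abs_tan_sub_tan_le hαθ hβφ
        have h2 : |α - θ - (β - φ)| ≤ L + δ :=
          abs_le.mpr ⟨by linarith [hα.1, hβ.2, hθ.2, hφ.1], by linarith [hα.2, hβ.1, hθ.1, hφ.2]⟩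
        rw [abs_le] at h1 hr ht ⊢
        constructor <;> linarith [h1.1, h1.2, hr.1, hr.2, ht.1, ht.2])
      (by
        rintro r ⟨p, q, hq, hqQ, rfl, -⟩ t ⟨p', q', hq', hqQ', rfl, -⟩ hne
        exact inv_sq_le_abs_sub_of_ne hq hq' hqQ hqQ' hne)
    refine ⟨F, hcard.trans ?_, fun α hα θ hθ hαθ p q hq hqQ hr =>
      hSF ⟨p, q, hq, hqQ, rfl, α, hα, θ, hθ, hαθ, hr⟩⟩
    have hpow : ((2 ^ (k + 1) : ℕ) : ℝ) ^ 2 = 4 * 4 ^ k := by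
      push_cast
      rw [← pow_mul, mul_comm, pow_mul, pow_succ]
      norm_num
      ring
    rw [hpow, div_div_eq_mul_div, div_one]
    nlinarith
  choose F hFcard hFmem using hF
  refine ⟨s.biUnion fun x => (F x).image fun r => x + Real.arctan r, ?_, ?_⟩
  · have h1 : ((s.biUnion fun x => (F x).image fun r => x + Real.arctan r).card : ℝ) ≤
        ∑ x ∈ s, ((F x).card : ℝ) := by
      exact_mod_cast Finset.card_biUnion_le.trans
        (Finset.sum_le_sum fun x _ => Finset.card_image_le)
    have h2 : ∑ x ∈ s, ((F x).card : ℝ) ≤ s.card * (2 + 16 * 4 ^ k * L) := by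
      rw [← nsmul_eq_mul]
      exact Finset.sum_le_card_nsmul _ _ _ fun x _ => hFcard x
    exact (h1.trans h2).trans (by gcongr)
  · intro α hα hP θ hθ p q hq hqQ
    by_contra hle
    rw [not_lt, ← hδdef] at hle
    have hpi := Real.pi_pos
    have hαθ : |α - θ| ≤ Real.pi / 3 :=
      abs_le.mpr ⟨by linarith [hα.1, (hΩ hθ).2], by linarith [hα.2, (hΩ hθ).1]⟩
    obtain ⟨x, hxs, hx⟩ : ∃ x ∈ s, θ ∈ Set.Icc x (x + δ) := by
      simpa only [Set.mem_iUnion, exists_prop] using hΩs hθ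
    have hmem := hFmem x α hα θ hx hαθ p q hq hqQ hle
    have hfar := hP (x + Real.arctan ((p : ℝ) / q))
      (Finset.mem_biUnion.mpr ⟨x, hxs, Finset.mem_image_of_mem _ hmem⟩)
    have harc := (abs_arctan_sub_arctan_le (Real.tan (α - θ)) ((p : ℝ) / q)).trans hle
    rw [Real.arctan_tan (by linarith [(abs_le.mp hαθ).1]) (by linarith [(abs_le.mp hαθ).2])]
      at harc
    apply hfar.not_ge
    rw [abs_le] at harc ⊢
    constructor <;> linarith [harc.1, harc.2, hx.1, hx.2]

/-- The length of the interval surviving all levels below `N`. -/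
def survivorLength (M : ℕ) (A : ℝ) (N : ℕ) : ℝ := A / ((4 : ℝ) ^ N * (N : ℝ) ^ M)

theorem sum_Ico_four_pow_le (N : ℕ) :
    ∑ m ∈ Finset.Ico N (2 * N), (4 : ℝ) ^ m ≤ 4 ^ (2 * N) := by
  rw [geom_sum_Ico (by norm_num) (by omega)]
  have : (0 : ℝ) < 4 ^ N := by positivity
  have : (0 : ℝ) < 4 ^ (2 * N) := by positivity
  linarith

theorem sum_Ico_inv_four_pow_le (N : ℕ) :
    ∑ m ∈ Finset.Ico N (2 * N), 1 / (4 : ℝ) ^ m ≤ 2 / 4 ^ N := by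
  have h : ∑ m ∈ Finset.Ico N (2 * N), (1 / 4 : ℝ) ^ m ≤ 2 * (1 / 4) ^ N := by
    rw [geom_sum_Ico (by norm_num) (by omega)]
    have h1 : (0 : ℝ) < (1 / 4) ^ N := by positivity
    have h2 : (0 : ℝ) < (1 / 4) ^ (2 * N) := by positivity
    rw [div_le_iff_of_neg (by norm_num)]
    linarith
  simpa [div_eq_mul_inv] using h

/-- The total weight of the intervals removed at the levels from `N` to `2 * N`. -/
theorem sum_removed_lt {M R N : ℕ} {B L ℓ : ℝ} (hM : 1 ≤ M) (hB : 1 ≤ B) (hN2 : 2 ≤ N)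
    (hR : 2 ^ 14 * B ^ 2 ≤ 4 ^ R) (hN : 16 * B * (N : ℝ) ^ (M + 1) ≤ 4 ^ N)
    (hL : L = survivorLength M (128 * B) N) (hℓ : ℓ = survivorLength M (128 * B) (2 * N)) :
    ∑ m ∈ Finset.Ico N (2 * N), B * (m : ℝ) ^ M * (2 + 16 * (4 ^ m / 4 ^ R) * L) *
      (2 * (2 * levelRadius M m) + ℓ) < L - ℓ := by
  have hNpos : (2 : ℝ) ≤ N := by exact_mod_cast hN2
  have hNpos' : (0 : ℝ) < N := by linarith
  have hLpos : 0 < L := by rw [hL]; unfold survivorLength; positivity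
  have hℓpos : 0 < ℓ := by
    rw [hℓ]; unfold survivorLength; push_cast; positivity
  set X : ℝ := (N : ℝ) ^ M with hX
  set Y : ℝ := ((2 * N : ℕ) : ℝ) ^ M with hY
  have hXpos : 0 < X := by positivity
  have hYpos : 0 < Y := by rw [hY]; push_cast; positivity
  have hNX : (N : ℝ) ≤ X := le_self_pow₀ (by linarith) (by omega)
  have hXY : X ≤ Y := by
    rw [hX, hY]; push_cast; gcongr; linarith
  have hterm : ∀ m ∈ Finset.Ico N (2 * N),
      B * (m : ℝ) ^ M * (2 + 16 * (4 ^ m / 4 ^ R) * L) * (2 * (2 * levelRadius M m) + ℓ) ≤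
        8 * B / X * (1 / 4 ^ m) + 64 * B * L / 4 ^ R / X + 2 * B * Y * ℓ +
          16 * B * L * Y * ℓ / 4 ^ R * 4 ^ m := by
    intro m hm
    obtain ⟨hm1, hm2⟩ := Finset.mem_Ico.mp hm
    have hmpos : (0 : ℝ) < m := by
      have : 0 < m := by omega
      exact_mod_cast this
    have hXm : X ≤ (m : ℝ) ^ M := by rw [hX]; gcongr
    have hmY : (m : ℝ) ^ M ≤ Y := by rw [hY]; gcongr
    have heq : B * (m : ℝ) ^ M * (2 + 16 * (4 ^ m / 4 ^ R) * L) *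
        (2 * (2 * levelRadius M m) + ℓ) =
        8 * B / (m : ℝ) ^ M * (1 / 4 ^ m) + 64 * B * L / 4 ^ R / (m : ℝ) ^ M +
          2 * B * (m : ℝ) ^ M * ℓ + 16 * B * L * (m : ℝ) ^ M * ℓ / 4 ^ R * 4 ^ m := by
      unfold levelRadius
      have : (m : ℝ) ^ (2 * M) = (m : ℝ) ^ M * (m : ℝ) ^ M := by rw [two_mul, pow_add]
      rw [this]
      field_simp
      ring
    rw [heq]
    gcongr
  have hsum1 := sum_Ico_inv_four_pow_le N
  have hsum2 := sum_Ico_four_pow_le N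
  have htotal := Finset.sum_le_sum hterm
  rw [Finset.sum_add_distrib, Finset.sum_add_distrib, Finset.sum_add_distrib, Finset.sum_const,
    Finset.sum_const, ← Finset.mul_sum, ← Finset.mul_sum, Nat.card_Ico, nsmul_eq_mul, nsmul_eq_mul,
    show 2 * N - N = N by omega] at htotal
  have hLX : L * (4 ^ N * X) = 128 * B := by
    rw [hL, survivorLength, ← hX]; field_simp
  have hℓY : ℓ * (4 ^ (2 * N) * Y) = 128 * B := by
    rw [hℓ, survivorLength, ← hY]; field_simp
  have h4R : 0 < (4 : ℝ) ^ R := by positivity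
  have hA : 8 * B / X * ∑ m ∈ Finset.Ico N (2 * N), 1 / (4 : ℝ) ^ m ≤ L / 8 := by
    calc _ ≤ 8 * B / X * (2 / 4 ^ N) := by gcongr
      _ = L / 8 := by
        rw [hL, survivorLength]; field_simp; ring
  have hC : (N : ℝ) * (64 * B * L / 4 ^ R / X) ≤ L / 8 := by
    have h1 : 64 * B * L / 4 ^ R ≤ L / 8 := by
      rw [div_le_iff₀ h4R]
      have : 512 * B ≤ 4 ^ R := by nlinarith
      nlinarith
    calc (N : ℝ) * (64 * B * L / 4 ^ R / X) = (64 * B * L / 4 ^ R) * (N / X) := by ring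
      _ ≤ (L / 8) * 1 := by
        gcongr
        exact (div_le_one hXpos).mpr hNX
      _ = L / 8 := mul_one _
  have hD : (N : ℝ) * (2 * B * Y * ℓ) ≤ L / 8 := by
    have h2N : (4 : ℝ) ^ (2 * N) = 4 ^ N * 4 ^ N := by rw [two_mul, pow_add]
    have h4N : 0 < (4 : ℝ) ^ N := by positivity
    have hYℓ : Y * ℓ = 128 * B / (4 ^ N * 4 ^ N) := by
      rw [eq_div_iff (by positivity), ← h2N, ← hℓY]; ring
    have hLeq : L = 128 * B / (4 ^ N * X) := by rw [hL, survivorLength]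
    have hN' : 16 * B * (N * X) ≤ 4 ^ N := by
      calc 16 * B * (N * X) = 16 * B * (N : ℝ) ^ (M + 1) := by rw [hX]; ring
        _ ≤ _ := hN
    calc (N : ℝ) * (2 * B * Y * ℓ) = 2 * B * N * (Y * ℓ) := by ring
      _ = 16 * B * (N * X) * (16 * B / (4 ^ N * 4 ^ N * X)) := by
        rw [hYℓ]; field_simp; ring
      _ ≤ 4 ^ N * (16 * B / (4 ^ N * 4 ^ N * X)) := by gcongr
      _ = L / 8 := by rw [hLeq]; field_simp; ring
  have hE : 16 * B * L * Y * ℓ / 4 ^ R * ∑ m ∈ Finset.Ico N (2 * N), (4 : ℝ) ^ m ≤ L / 8 := by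
    calc _ ≤ 16 * B * L * Y * ℓ / 4 ^ R * 4 ^ (2 * N) := by gcongr
      _ = 16 * B * L / 4 ^ R * (ℓ * (4 ^ (2 * N) * Y)) := by ring
      _ = L / 8 * (2 ^ 14 * B ^ 2 / 4 ^ R) := by rw [hℓY]; ring
      _ ≤ L / 8 * 1 := by
        gcongr
        exact (div_le_one h4R).mpr hR
      _ = L / 8 := mul_one _
  have hG : ℓ ≤ L / 8 := by
    have h2N : (4 : ℝ) ^ (2 * N) = 4 ^ N * 4 ^ N := by rw [two_mul, pow_add]
    have h16 : (8 : ℝ) ≤ 4 ^ N := by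
      calc (8 : ℝ) ≤ 4 ^ 2 := by norm_num
        _ ≤ 4 ^ N := pow_le_pow_right₀ (by norm_num) hN2
    have : ℓ * (4 ^ (2 * N) * Y) ≤ L / 8 * (4 ^ (2 * N) * Y) := by
      calc ℓ * (4 ^ (2 * N) * Y) = L * (4 ^ N * X) := by rw [hℓY, hLX]
        _ ≤ L * (4 ^ N * Y) * (4 ^ N / 8) := by
          rw [← mul_one (L * (4 ^ N * X))]
          gcongr
          linarith
        _ = _ := by rw [h2N]; ring
    exact le_of_mul_le_mul_right this (by positivity)
  linarith

/-- A surviving interval at stage `N` contains a surviving interval at stage `2 * N`. -/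
theorem exists_next_interval {Ω : Set ℝ} {M R N : ℕ} {B a : ℝ} (hM : 1 ≤ M)
    (hΩ : Ω ⊆ Set.Icc 0 (Real.pi / 2)) (hB : 1 ≤ B) (hR3 : 3 ≤ R) (hRN : R ≤ N)
    (hcover : ∀ m : ℕ, 0 < m → ∃ s : Finset ℝ, (s.card : ℝ) ≤ B * (m : ℝ) ^ M ∧
      Ω ⊆ ⋃ x ∈ s, Set.Icc x (x + levelRadius M m))
    (hR : 2 ^ 14 * B ^ 2 ≤ 4 ^ R) (hN : 16 * B * (N : ℝ) ^ (M + 1) ≤ 4 ^ N)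
    (ha : Real.pi / 6 ≤ a) (haL : a + survivorLength M (128 * B) N ≤ Real.pi / 3) :
    ∃ b : ℝ, a ≤ b ∧ b + survivorLength M (128 * B) (2 * N) ≤
        a + survivorLength M (128 * B) N ∧
      ∀ α ∈ Set.Icc b (b + survivorLength M (128 * B) (2 * N)),
        ∀ k : ℕ, N ≤ k + R → k + R < 2 * N → GoodAt Ω M R k α := by
  set L := survivorLength M (128 * B) N with hL
  set ℓ := survivorLength M (128 * B) (2 * N) with hℓ
  have hL0 : 0 ≤ L := by rw [hL]; unfold survivorLength; positivity
  have hℓ0 : 0 ≤ ℓ := by rw [hℓ]; unfold survivorLength; positivity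
  have hP : ∀ k : ℕ, ∃ P : Finset ℝ,
      (P.card : ℝ) ≤ B * ((k + R : ℕ) : ℝ) ^ M * (2 + 16 * 4 ^ k * L) ∧
      ∀ α ∈ Set.Icc a (a + L), (∀ c ∈ P, 2 * levelRadius M (k + R) < |α - c|) →
        GoodAt Ω M R k α := fun k =>
    exists_centres hΩ hR3 hL0 ha haL (hcover (k + R) (by omega))
  choose P hPcard hPgood using hP
  have hrad : ∀ m ∈ Finset.Ico N (2 * N), 0 ≤ 2 * levelRadius M m := fun m hm => by
    have := levelRadius_pos M (m := m) (by have := (Finset.mem_Ico.mp hm).1; omega)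
    positivity
  obtain ⟨b, hb, hgood⟩ := exists_subinterval_avoiding (a := a) (L := L) (Finset.Ico N (2 * N))
    (fun m => P (m - R)) (fun m => 2 * levelRadius M m) hrad hℓ0 (by
      refine (Finset.sum_le_sum fun m hm => ?_).trans_lt
        (sum_removed_lt hM hB (by omega) hR hN hL hℓ)
      have hm0 := hrad m hm
      have hRm : R ≤ m := hRN.trans (Finset.mem_Ico.mp hm).1
      have hc := hPcard (m - R)
      rw [Nat.sub_add_cancel hRm, pow_sub₀ _ (by norm_num) hRm, ← div_eq_mul_inv] at hc
      gcongr)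
  refine ⟨b, hb.1, by linarith [hb.2], fun α hα k hk1 hk2 => ?_⟩
  refine hPgood k α ⟨hb.1.trans hα.1, by linarith [hb.2, hα.2]⟩ fun c hc => ?_
  exact hgood α hα (k + R) (Finset.mem_Ico.mpr ⟨hk1, hk2⟩) c (by simpa using hc)

/-- For a lacunary set there is an angle which is good at all levels. -/
theorem exists_forall_goodAt {Ω : Set ℝ} {M : ℕ} (hM : 1 ≤ M)
    (hΩ : Ω ⊆ Set.Icc 0 (Real.pi / 2)) (hcov : LacunaryCovering Ω M) :
    ∃ R : ℕ, 0 < R ∧ ∃ α ∈ Set.Icc (0 : ℝ) (Real.pi / 2), ∀ k : ℕ, GoodAt Ω M R k α := by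
  obtain ⟨B, hB, hcover⟩ := hcov.exists_levelRadius_cover
  have hlarge : ∀ᶠ N : ℕ in Filter.atTop, 16 * B * (N : ℝ) ^ (M + 1) ≤ 4 ^ N := by
    have h := (tendsto_pow_const_div_const_pow_of_one_lt (M + 1)
      (by norm_num : (1 : ℝ) < 4)).eventually_le_const (u := 1 / (16 * B)) (by positivity)
    filter_upwards [h] with N hN
    rw [div_le_div_iff₀ (by positivity) (by positivity)] at hN
    linarith
  obtain ⟨N₀, hN₀⟩ := Filter.eventually_atTop.mp hlarge
  obtain ⟨R₀, hR₀⟩ := pow_unbounded_of_one_lt (2 ^ 14 * B ^ 2) (by norm_num : (1 : ℝ) < 4)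
  set R := max (max N₀ R₀) 3 with hRdef
  have hR3 : 3 ≤ R := le_max_right _ _
  have hRN₀ : N₀ ≤ R := (le_max_left _ _).trans (le_max_left _ _)
  have hR : 2 ^ 14 * B ^ 2 ≤ 4 ^ R :=
    hR₀.le.trans (pow_le_pow_right₀ (by norm_num) ((le_max_right _ _).trans (le_max_left _ _)))
  have hlen : ∀ n, 0 ≤ survivorLength M (128 * B) n := fun n => by
    unfold survivorLength; positivity
  have hstart : Real.pi / 6 + survivorLength M (128 * B) R ≤ Real.pi / 3 := by
    have h1 : (1 : ℝ) ≤ (R : ℝ) ^ M := one_le_pow₀ (by exact_mod_cast (by omega : 1 ≤ R))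
    have h2 : survivorLength M (128 * B) R ≤ 1 / 2 := by
      unfold survivorLength
      rw [div_le_iff₀ (by positivity)]
      have : 2 ^ 8 * B ≤ 4 ^ R := by nlinarith
      nlinarith
    linarith [Real.pi_gt_three]
  have hstep : ∀ (i : ℕ) (a : ℝ), ∃ b : ℝ, Real.pi / 6 ≤ a →
      a + survivorLength M (128 * B) (2 ^ i * R) ≤ Real.pi / 3 →
      a ≤ b ∧ b + survivorLength M (128 * B) (2 ^ (i + 1) * R) ≤
          a + survivorLength M (128 * B) (2 ^ i * R) ∧
        ∀ α ∈ Set.Icc b (b + survivorLength M (128 * B) (2 ^ (i + 1) * R)),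
          ∀ k : ℕ, 2 ^ i * R ≤ k + R → k + R < 2 ^ (i + 1) * R → GoodAt Ω M R k α := by
    intro i a
    by_cases h : Real.pi / 6 ≤ a ∧ a + survivorLength M (128 * B) (2 ^ i * R) ≤ Real.pi / 3
    · have hRi : R ≤ 2 ^ i * R := Nat.le_mul_of_pos_left R (by positivity)
      obtain ⟨b, hb⟩ := exists_next_interval hM hΩ hB hR3 hRi hcover hR
        (hN₀ _ (hRN₀.trans hRi)) h.1 h.2
      rw [show 2 * (2 ^ i * R) = 2 ^ (i + 1) * R by ring] at hb
      exact ⟨b, fun _ _ => hb⟩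
    · exact ⟨a, fun h1 h2 => absurd ⟨h1, h2⟩ h⟩
  choose next hnext using hstep
  obtain ⟨u, hu0, husucc⟩ : ∃ u : ℕ → ℝ, u 0 = Real.pi / 6 ∧ ∀ i, u (i + 1) = next i (u i) :=
    ⟨fun n => Nat.rec (Real.pi / 6) (fun i a => next i a) n, rfl, fun _ => rfl⟩
  have hu : ∀ i, Real.pi / 6 ≤ u i ∧
      u i + survivorLength M (128 * B) (2 ^ i * R) ≤ Real.pi / 3 := by
    intro i
    induction i with
    | zero => exact ⟨hu0.ge, by simpa [hu0] using hstart⟩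
    | succ i ih =>
      obtain ⟨h1, h2, -⟩ := hnext i (u i) ih.1 ih.2
      rw [husucc]
      exact ⟨ih.1.trans h1, h2.trans ih.2⟩
  have hu' := fun i => hnext i (u i) (hu i).1 (hu i).2
  simp only [← husucc] at hu'
  obtain ⟨α, hα⟩ := IsCompact.nonempty_iInter_of_sequence_nonempty_isCompact_isClosed
    (fun i => Set.Icc (u i) (u i + survivorLength M (128 * B) (2 ^ i * R)))
    (fun i => Set.Icc_subset_Icc (hu' i).1 (hu' i).2.1)
    (fun i => Set.nonempty_Icc.mpr (by linarith [hlen (2 ^ i * R)]))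
    isCompact_Icc (fun i => isClosed_Icc)
  rw [Set.mem_iInter] at hα
  have hpi := Real.pi_pos
  refine ⟨R, by omega, α,
    ⟨by linarith [(hα 0).1, (hu 0).1], (hα 0).2.trans ((hu 0).2.trans (by linarith))⟩, fun k => ?_⟩
  have hex : ∃ i, k + R < 2 ^ (i + 1) * R := ⟨k, by
    have h1 : k < 2 ^ k := Nat.lt_two_pow_self
    rw [pow_succ]
    nlinarith⟩
  classical
  refine (hu' (Nat.find hex)).2.2 α (hα (Nat.find hex + 1)) k ?_ (Nat.find_spec hex)
  rcases Nat.eq_zero_or_pos (Nat.find hex) with h0 | hpos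
  · rw [h0]; omega
  · have h := Nat.find_min hex (Nat.sub_lt hpos one_pos)
    rw [show Nat.find hex - 1 + 1 = Nat.find hex by omega] at h
    exact not_lt.mp h

/-- If `Ω ⊆ [0, π/2]` is lacunary of order `M ≥ 1`, there exist `α ∈ [0, π/2]` and
`C > 0` such that for all `θ ∈ Ω`, all integers `p` and all positive integers `q`,
`|tan(α - θ) - p/q| > C / (q² (log q)^{2M})`. -/
theorem lacunary_order_M_diophantine
    (M : ℕ) (hM : 1 ≤ M) (Ω : Set ℝ) (hΩ : Ω ⊆ Set.Icc 0 (Real.pi / 2))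
    (hcov : LacunaryCovering Ω M) :
    ∃ α ∈ Set.Icc (0:ℝ) (Real.pi / 2), ∃ C : ℝ, 0 < C ∧
      ∀ θ ∈ Ω, ∀ (p : ℤ) (q : ℕ), 0 < q →
        |Real.tan (α - θ) - (p : ℝ) / (q : ℝ)| >
          C / ((q : ℝ) ^ 2 * (plog q) ^ (2 * M)) := by
  obtain ⟨R, hR, α, hα, hgood⟩ := exists_forall_goodAt hM hΩ hcov
  refine ⟨α, hα, 1 / (4 ^ R * (1 + R) ^ (2 * M)), by positivity, fun θ hθ p q hq => ?_⟩
  set k := Nat.log 2 q with hk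
  have hkR : 0 < k + R := by omega
  have hklow : 2 ^ k ≤ q := Nat.pow_log_le_self 2 hq.ne'
  have hqlow : (4 : ℝ) ^ k ≤ (q : ℝ) ^ 2 := by
    have h : ((2 : ℝ) ^ k) ≤ q := by exact_mod_cast hklow
    calc (4 : ℝ) ^ k = (2 ^ k) ^ 2 := by rw [← pow_mul, mul_comm, pow_mul]; norm_num
      _ ≤ _ := by gcongr
  have hplog1 : 1 ≤ plog q := le_max_left _ _
  have hplogk : (k : ℝ) ≤ plog q := by
    refine le_max_of_le_right ?_
    rw [Real.le_logb_iff_rpow_le (by norm_num) (by exact_mod_cast hq), Real.rpow_natCast]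
    exact_mod_cast hklow
  refine lt_of_le_of_lt ?_ (hgood k θ hθ p q hq (Nat.lt_pow_succ_log_self (by norm_num) q))
  unfold levelRadius
  rw [div_div]
  have hkRpos : (0 : ℝ) < ((k + R : ℕ) : ℝ) := by exact_mod_cast hkR
  apply one_div_le_one_div_of_le (by positivity)
  have hbase : ((k + R : ℕ) : ℝ) ≤ (1 + R) * plog q := by
    push_cast
    have : (0 : ℝ) ≤ R := by positivity
    nlinarith
  calc (4 : ℝ) ^ (k + R) * ((k + R : ℕ) : ℝ) ^ (2 * M)
      ≤ 4 ^ k * 4 ^ R * ((1 + R) * plog q) ^ (2 * M) := by rw [pow_add]; gcongr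
    _ ≤ (q : ℝ) ^ 2 * 4 ^ R * ((1 + R) * plog q) ^ (2 * M) := by gcongr
    _ = _ := by rw [mul_pow]; ring

end
end
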